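/- Let 1 < p < ∞, μ > 0, τ_s > 0, γ > 0, let Ω be a measurable subset of ℝ^d with Lebesgue measure, and define G(A) := μ|A|^{p−2}A + γ τ_s A / max(τ_s, γ|A|) on ℝ^{d×d} (with μ|A|^{p−2}A understood as 0 when A = 0). If θ, ψ : Ω → ℝ^{d×d} are measurable matrix fields such that the (pointwise nonnegative) function x ↦ ⟨G(θ(x)) − G(ψ(x)), θ(x) − ψ(x)⟩ has Lebesgue integral equal to 0 over Ω, then θ(x) = ψ(x) for almost every x ∈ Ω. -/

import Mathlib

open MeasureTheory Real Set

/-- The Frobenius inner product on real `d × d` matrices: `⟨A,B⟩ = tr (A Bᵀ)`. -/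
noncomputable def frobInner {d : ℕ} (A B : Matrix (Fin d) (Fin d) ℝ) : ℝ :=
  Matrix.trace (A * Matrix.transpose B)

/-- The Frobenius norm `|A| = √⟨A,A⟩`. -/
noncomputable def frobNorm {d : ℕ} (A : Matrix (Fin d) (Fin d) ℝ) : ℝ :=
  Real.sqrt (frobInner A A)

/-- The Huber-regularized modulus `|A|_γ = max (τ_s, γ |A|)`. -/
noncomputable def huberMod {d : ℕ} (τs γ : ℝ) (A : Matrix (Fin d) (Fin d) ℝ) : ℝ :=
  max τs (γ * frobNorm A)

/-- The Huber map `H_γ(A) = γ τ_s A / |A|_γ`. -/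
noncomputable def huberMap {d : ℕ} (τs γ : ℝ) (A : Matrix (Fin d) (Fin d) ℝ) :
    Matrix (Fin d) (Fin d) ℝ :=
  (γ * τs / huberMod τs γ A) • A

/-- The regularized Herschel–Bulkley map
`G(A) = μ |A|^(p-2) A + γ τ_s A / max (τ_s, γ|A|)`
(the first term is `0` when `A = 0`, since it is a scalar multiple of `A`). -/
noncomputable def regHB {d : ℕ} (p μ τs γ : ℝ) (A : Matrix (Fin d) (Fin d) ℝ) :
    Matrix (Fin d) (Fin d) ℝ :=
  (μ * frobNorm A ^ (p - 2)) • A + huberMap τs γ A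

instance {d : ℕ} : MeasurableSpace (Matrix (Fin d) (Fin d) ℝ) :=
  MeasurableSpace.pi

/-- The scalar factor `c(a) = μ a^(p-2) + γ τ_s / max (τ_s, γ a)` with `G(A) = c(|A|) A`. -/
noncomputable def regHBCoeff (p μ τs γ a : ℝ) : ℝ :=
  μ * a ^ (p - 2) + γ * τs / max τs (γ * a)

theorem regHB_eq_coeff_smul {d : ℕ} (p μ τs γ : ℝ) (A : Matrix (Fin d) (Fin d) ℝ) :
    regHB p μ τs γ A = regHBCoeff p μ τs γ (frobNorm A) • A := by
  simp only [regHB, huberMap, huberMod, regHBCoeff, add_smul]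

theorem regHBCoeff_pos {p μ τs γ a : ℝ} (hμ : 0 < μ) (hτ : 0 < τs) (hγ : 0 < γ) (ha : 0 ≤ a) :
    0 < regHBCoeff p μ τs γ a := by
  have hmax : 0 < max τs (γ * a) := lt_max_of_lt_left hτ
  unfold regHBCoeff
  positivity

theorem regHBCoeff_mul_self_lt {p μ τs γ a b : ℝ} (hp : 1 < p) (hμ : 0 < μ) (hτ : 0 < τs)
    (hγ : 0 < γ) (ha : 0 ≤ a) (hab : a < b) :
    regHBCoeff p μ τs γ a * a < regHBCoeff p μ τs γ b * b := by
  have rpow_mul_self : ∀ t : ℝ, 0 ≤ t → t ^ (p - 2) * t = t ^ (p - 1) := by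
    intro t ht
    rcases ht.eq_or_lt with rfl | ht
    · rw [mul_zero, Real.zero_rpow (by linarith)]
    · rw [← Real.rpow_add_one ht.ne']
      congr 1
      ring
  have hpow : a ^ (p - 1) < b ^ (p - 1) := Real.rpow_lt_rpow ha hab (by linarith)
  have hma : 0 < max τs (γ * a) := lt_max_of_lt_left hτ
  have hmb : 0 < max τs (γ * b) := lt_max_of_lt_left hτ
  have hcross : a * max τs (γ * b) ≤ b * max τs (γ * a) := by
    rw [mul_max_of_nonneg _ _ ha, mul_max_of_nonneg _ _ (ha.trans hab.le)]
    apply max_le_max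
    · gcongr
    · exact le_of_eq (by ring)
  have hhuber : γ * τs / max τs (γ * a) * a ≤ γ * τs / max τs (γ * b) * b := by
    rw [div_mul_eq_mul_div, div_mul_eq_mul_div, div_le_div_iff₀ hma hmb,
      mul_assoc (γ * τs), mul_assoc (γ * τs)]
    gcongr
  unfold regHBCoeff
  rw [add_mul, add_mul, mul_assoc μ, mul_assoc μ, rpow_mul_self a ha,
    rpow_mul_self b (ha.trans hab.le)]
  exact add_lt_add_of_lt_of_le (by gcongr) hhuber

theorem frobInner_eq_sum {d : ℕ} (A B : Matrix (Fin d) (Fin d) ℝ) :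
    frobInner A B = ∑ ij : Fin d × Fin d, A ij.1 ij.2 * B ij.1 ij.2 := by
  simp [frobInner, Matrix.trace, Matrix.mul_apply, Fintype.sum_prod_type]

theorem frobInner_self_nonneg {d : ℕ} (A : Matrix (Fin d) (Fin d) ℝ) : 0 ≤ frobInner A A := by
  rw [frobInner_eq_sum]
  exact Finset.sum_nonneg fun _ _ => mul_self_nonneg _

theorem frobNorm_nonneg {d : ℕ} (A : Matrix (Fin d) (Fin d) ℝ) : 0 ≤ frobNorm A :=
  Real.sqrt_nonneg _

theorem frobNorm_mul_self {d : ℕ} (A : Matrix (Fin d) (Fin d) ℝ) :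
    frobNorm A * frobNorm A = frobInner A A :=
  Real.mul_self_sqrt (frobInner_self_nonneg A)

theorem frobInner_le_frobNorm_mul {d : ℕ} (A B : Matrix (Fin d) (Fin d) ℝ) :
    frobInner A B ≤ frobNorm A * frobNorm B := by
  simp only [frobNorm, frobInner_eq_sum, ← pow_two]
  exact Real.sum_mul_le_sqrt_mul_sqrt _ _ _

theorem eq_zero_of_frobInner_self_eq_zero {d : ℕ} {A : Matrix (Fin d) (Fin d) ℝ}
    (h : frobInner A A = 0) : A = 0 := by
  rw [frobInner_eq_sum, Finset.sum_eq_zero_iff_of_nonneg fun _ _ => mul_self_nonneg _] at h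
  ext i j
  exact mul_self_eq_zero.mp (h (i, j) (Finset.mem_univ _))

theorem frobInner_smul_sub_smul_sub {d : ℕ} (s t : ℝ) (A B : Matrix (Fin d) (Fin d) ℝ) :
    frobInner (s • A - t • B) (A - B) =
      s * frobInner A A + t * frobInner B B - (s + t) * frobInner A B := by
  simp only [frobInner_eq_sum, Finset.mul_sum, ← Finset.sum_add_distrib, ← Finset.sum_sub_distrib]
  refine Finset.sum_congr rfl fun _ _ => ?_
  simp only [Matrix.sub_apply, Matrix.smul_apply, smul_eq_mul]
  ring

/-- Strict monotonicity of the regularized Herschel–Bulkley map. -/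
theorem eq_of_frobInner_regHB_sub_nonpos {d : ℕ} {p μ τs γ : ℝ} (hp : 1 < p) (hμ : 0 < μ)
    (hτ : 0 < τs) (hγ : 0 < γ) {A B : Matrix (Fin d) (Fin d) ℝ}
    (h : frobInner (regHB p μ τs γ A - regHB p μ τs γ B) (A - B) ≤ 0) : A = B := by
  rw [regHB_eq_coeff_smul, regHB_eq_coeff_smul, frobInner_smul_sub_smul_sub,
    ← frobNorm_mul_self, ← frobNorm_mul_self] at h
  have hCS := frobInner_le_frobNorm_mul A B
  have ha := frobNorm_nonneg A
  have hb := frobNorm_nonneg B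
  have hca := regHBCoeff_pos (p := p) hμ hτ hγ ha
  have hcb := regHBCoeff_pos (p := p) hμ hτ hγ hb
  have hdist := frobInner_smul_sub_smul_sub 1 1 A B
  rw [one_smul, one_smul, ← frobNorm_mul_self A, ← frobNorm_mul_self B] at hdist
  have hlt := @regHBCoeff_mul_self_lt p μ τs γ (frobNorm A) (frobNorm B) hp hμ hτ hγ ha
  have hgt := @regHBCoeff_mul_self_lt p μ τs γ (frobNorm B) (frobNorm A) hp hμ hτ hγ hb
  generalize regHBCoeff p μ τs γ (frobNorm A) = s at *
  generalize regHBCoeff p μ τs γ (frobNorm B) = t at *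
  generalize frobNorm A = a at *
  generalize frobNorm B = b at *
  have hprod : 0 ≤ (s + t) * (a * b - frobInner A B) :=
    mul_nonneg (by linarith) (by linarith)
  have hab : a = b := by
    rcases lt_trichotomy a b with hab | hab | hab
    · nlinarith [mul_pos (sub_pos.mpr (hlt hab)) (sub_pos.mpr hab)]
    · exact hab
    · nlinarith [mul_pos (sub_pos.mpr (hgt hab)) (sub_pos.mpr hab)]
  subst hab
  have hle : a * a - frobInner A B ≤ 0 := by
    by_contra! hpos
    nlinarith [mul_pos (add_pos hca hcb) hpos]
  exact sub_eq_zero.mp (eq_zero_of_frobInner_self_eq_zero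
    (le_antisymm (by linarith) (frobInner_self_nonneg _)))

theorem measurable_frobInner {α : Type*} [MeasurableSpace α] {d : ℕ}
    {f g : α → Matrix (Fin d) (Fin d) ℝ} (hf : ∀ i j, Measurable fun x => f x i j)
    (hg : ∀ i j, Measurable fun x => g x i j) : Measurable fun x => frobInner (f x) (g x) := by
  simp only [frobInner_eq_sum]
  exact Finset.measurable_sum _ fun ij _ => (hf ij.1 ij.2).mul (hg ij.1 ij.2)

theorem measurable_regHB_apply {α : Type*} [MeasurableSpace α] {d : ℕ} (p μ τs γ : ℝ)
    {f : α → Matrix (Fin d) (Fin d) ℝ} (hf : ∀ i j, Measurable fun x => f x i j) (i j : Fin d) :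
    Measurable fun x => regHB p μ τs γ (f x) i j := by
  have hnorm : Measurable fun x => frobNorm (f x) := (measurable_frobInner hf hf).sqrt
  have hcoeff : Measurable fun x => regHBCoeff p μ τs γ (frobNorm (f x)) := by
    unfold regHBCoeff
    exact ((hnorm.pow_const _).const_mul _).add
      ((measurable_const.max (hnorm.const_mul _)).const_div _)
  simp only [regHB_eq_coeff_smul, Matrix.smul_apply, smul_eq_mul]
  exact hcoeff.mul (hf i j)

theorem regHB_integral_zero_ae_eq {d : ℕ} (p μ τs γ : ℝ) (hp : 1 < p) (hμ : 0 < μ)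
    (hτ : 0 < τs) (hγ : 0 < γ)
    (Ω : Set (EuclideanSpace ℝ (Fin d))) (hΩ : MeasurableSet Ω)
    (θ ψ : EuclideanSpace ℝ (Fin d) → Matrix (Fin d) (Fin d) ℝ)
    (hθ : Measurable θ) (hψ : Measurable ψ)
    (h0 : ∫⁻ x in Ω, ENNReal.ofReal
        (frobInner (regHB p μ τs γ (θ x) - regHB p μ τs γ (ψ x)) (θ x - ψ x)) = 0) :
    ∀ᵐ x ∂(volume.restrict Ω), θ x = ψ x := by
  have hθ' : ∀ i j, Measurable fun x => θ x i j := fun i j =>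
    measurable_pi_iff.mp (measurable_pi_iff.mp hθ i) j
  have hψ' : ∀ i j, Measurable fun x => ψ x i j := fun i j =>
    measurable_pi_iff.mp (measurable_pi_iff.mp hψ i) j
  have hmeas : Measurable fun x => ENNReal.ofReal
      (frobInner (regHB p μ τs γ (θ x) - regHB p μ τs γ (ψ x)) (θ x - ψ x)) :=
    (measurable_frobInner
      (fun i j => (measurable_regHB_apply p μ τs γ hθ' i j).sub
        (measurable_regHB_apply p μ τs γ hψ' i j))
      (fun i j => (hθ' i j).sub (hψ' i j))).ennreal_ofReal
  filter_upwards [(lintegral_eq_zero_iff hmeas).mp h0] with x hx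
  exact eq_of_frobInner_regHB_sub_nonpos hp hμ hτ hγ (ENNReal.ofReal_eq_zero.mp hx)
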